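/- Let d ≥ 1 be an integer, β ∈ (0, min(d,2)), T > 0, let σ, b : ℝ → ℝ be Lipschitz continuous with b bounded and inf_{x∈ℝ} |σ(x)| = σ₀ > 0, and let w : [0,T]×ℝ^d → ℝ be bounded and continuous. Fix (t,x) ∈ (0,T]×ℝ^d. Then for every z ∈ ℝ there exists an admissible h such that the unique bounded solution Φ^h of the skeleton equation satisfies Φ^h(t,x) = z. -/

import Mathlib

open MeasureTheory Real Set

noncomputable section

/-- Euclidean space `ℝ^d`. -/
abbrev Ed (d : ℕ) := EuclideanSpace ℝ (Fin d)

/-- The heat kernel `Λ(t,x) = (4πt)^{−d/2} exp(−|x|²/(4t))` on `ℝ^d`. -/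
def heatKernel (d : ℕ) (t : ℝ) (x : Ed d) : ℝ :=
  (4 * π * t) ^ (-(d : ℝ) / 2) * Real.exp (-‖x‖ ^ 2 / (4 * t))

/-- A measurable function `g : [0,T]×ℝ^d → ℝ` is admissible if
`∫₀ᵀ ∫∫ |g(s,y)| |g(s,y′)| |y−y′|^{−β} dy dy′ ds < ∞`. -/
def Admissible (d : ℕ) (β T : ℝ) (g : ℝ → Ed d → ℝ) : Prop :=
  Measurable (fun p : ℝ × Ed d => g p.1 p.2) ∧
  (∫⁻ s in Ioc (0 : ℝ) T, ∫⁻ y : Ed d, ∫⁻ y' : Ed d,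
    ENNReal.ofReal (|g s y| * |g s y'| * ‖y - y'‖ ^ (-β))) < ⊤

/-- `Φ` is a bounded measurable solution on `[0,T]×ℝ^d` of the skeleton equation
`Φ(t,x) = w(t,x) + ∫₀ᵗ ∫∫ Λ(t−s,x−y) σ(Φ(s,y)) |y−y′|^{−β} h(s,y′) dy′ dy ds
          + ∫₀ᵗ ∫ Λ(t−s,x−y) b(Φ(s,y)) dy ds`,
all integrals being absolutely convergent. -/
structure IsSkeletonSolution (d : ℕ) (β T : ℝ) (σ b : ℝ → ℝ)
    (w : ℝ → Ed d → ℝ) (h : ℝ → Ed d → ℝ) (Φ : ℝ → Ed d → ℝ) : Prop where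
  measurable : Measurable (fun p : ℝ × Ed d => Φ p.1 p.2)
  bounded : ∃ M : ℝ, ∀ t ∈ Icc (0 : ℝ) T, ∀ x : Ed d, |Φ t x| ≤ M
  abs_conv_noise : ∀ t ∈ Icc (0 : ℝ) T, ∀ x : Ed d,
    (∫⁻ s in Ioc (0 : ℝ) t, ∫⁻ y : Ed d, ∫⁻ y' : Ed d,
      ENNReal.ofReal
        (|heatKernel d (t - s) (x - y) * σ (Φ s y) * ‖y - y'‖ ^ (-β) * h s y'|)) < ⊤
  abs_conv_drift : ∀ t ∈ Icc (0 : ℝ) T, ∀ x : Ed d,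
    (∫⁻ s in Ioc (0 : ℝ) t, ∫⁻ y : Ed d,
      ENNReal.ofReal (|heatKernel d (t - s) (x - y) * b (Φ s y)|)) < ⊤
  eqn : ∀ t ∈ Icc (0 : ℝ) T, ∀ x : Ed d,
    Φ t x = w t x
      + (∫ s in Ioc (0 : ℝ) t, ∫ y : Ed d, ∫ y' : Ed d,
          heatKernel d (t - s) (x - y) * σ (Φ s y) * ‖y - y'‖ ^ (-β) * h s y')
      + ∫ s in Ioc (0 : ℝ) t, ∫ y : Ed d, heatKernel d (t - s) (x - y) * b (Φ s y)


lemma hk_nonneg {d : ℕ} {τ : ℝ} (hτ : 0 ≤ τ) (z : Ed d) : 0 ≤ heatKernel d τ z := by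
  unfold heatKernel; positivity

lemma hk_pos {d : ℕ} {τ : ℝ} (hτ : 0 < τ) (z : Ed d) : 0 < heatKernel d τ z := by
  unfold heatKernel; positivity

lemma hk_zero {d : ℕ} (hd : 1 ≤ d) (z : Ed d) : heatKernel d 0 z = 0 := by
  unfold heatKernel
  have : (-(d:ℝ)/2) ≠ 0 := by
    have : (0:ℝ) < d := by exact_mod_cast hd
    linarith
  simp [Real.zero_rpow this]

lemma hk_meas (d : ℕ) : Measurable (fun p : ℝ × Ed d => heatKernel d p.1 p.2) := by
  unfold heatKernel
  fun_prop

lemma hk_integral0 {d : ℕ} {τ : ℝ} (hτ : 0 < τ) : ∫ y : Ed d, heatKernel d τ y = 1 := by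
  unfold heatKernel
  rw [integral_const_mul]
  have h := GaussianFourier.integral_rexp_neg_mul_sq_norm (V := Ed d) (b := 1 / (4 * τ)) (by positivity)
  have e : ∀ v : Ed d, rexp (-‖v‖ ^ 2 / (4 * τ)) = rexp (-(1 / (4 * τ)) * ‖v‖ ^ 2) := by
    intro v; congr 1; ring
  simp_rw [e]
  rw [h]
  have : π / (1 / (4 * τ)) = 4 * π * τ := by field_simp
  rw [this, ← Real.rpow_add (by positivity)]
  simp [neg_div]

lemma hk_integral {d : ℕ} {τ : ℝ} (hτ : 0 < τ) (x : Ed d) :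
    ∫ y : Ed d, heatKernel d τ (x - y) = 1 := by
  rw [integral_sub_left_eq_self (fun y => heatKernel d τ y) volume x]
  exact hk_integral0 hτ

lemma hk_integrable {d : ℕ} (hd : 1 ≤ d) {τ : ℝ} (hτ : 0 ≤ τ) (x : Ed d) :
    Integrable (fun y : Ed d => heatKernel d τ (x - y)) := by
  rcases hτ.eq_or_lt with rfl | h
  · simp [hk_zero hd]
  · by_contra hc
    have := integral_undef hc
    rw [hk_integral h] at this
    norm_num at this

lemma hk_integral_le {d : ℕ} (hd : 1 ≤ d) {τ : ℝ} (hτ : 0 ≤ τ) (x : Ed d) :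
    ∫ y : Ed d, heatKernel d τ (x - y) ≤ 1 := by
  rcases hτ.eq_or_lt with rfl | h
  · simp [hk_zero hd]
  · rw [hk_integral h]

/-- the Duhamel operator -/
def GG (d : ℕ) (f : ℝ × Ed d → ℝ) (p : ℝ × Ed d) : ℝ :=
  ∫ s in Ioc (0 : ℝ) p.1, ∫ y : Ed d, heatKernel d (p.1 - s) (p.2 - y) * f (s, y)

/-- the weight -/
def rho (d : ℕ) (K : ℝ) (p : ℝ × Ed d) : ℝ := rexp (K * |p.1|)

lemma inner_integrable {d : ℕ} (hd : 1 ≤ d) {f : ℝ × Ed d → ℝ} (hf : Measurable f) {A K : ℝ}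
    (hA : ∀ q, |f q| ≤ A * rho d K q) {t s : ℝ} (hs : s ≤ t) (x : Ed d) :
    Integrable (fun y : Ed d => heatKernel d (t - s) (x - y) * f (s, y)) := by
  refine (hk_integrable hd (sub_nonneg.2 hs) x).mul_bdd (c := A * rexp (K * |s|)) ?_ ?_
  · exact (hf.comp (by fun_prop)).aestronglyMeasurable
  · exact Filter.Eventually.of_forall fun y => hA (s, y)

lemma inner_abs_le {d : ℕ} (hd : 1 ≤ d) {f : ℝ × Ed d → ℝ} {A K : ℝ}
    (hA0 : 0 ≤ A)
    (hA : ∀ q, |f q| ≤ A * rho d K q) {t s : ℝ} (hs : s ≤ t) (x : Ed d) :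
    |∫ y : Ed d, heatKernel d (t - s) (x - y) * f (s, y)| ≤ A * rexp (K * |s|) := by
  have h0 : 0 ≤ t - s := sub_nonneg.2 hs
  calc |∫ y : Ed d, heatKernel d (t - s) (x - y) * f (s, y)|
      ≤ ∫ y : Ed d, heatKernel d (t - s) (x - y) * (A * rexp (K * |s|)) := by
        rw [← Real.norm_eq_abs]
        refine norm_integral_le_of_norm_le ((hk_integrable hd h0 x).mul_const _) ?_
        refine Filter.Eventually.of_forall fun y => ?_
        rw [norm_mul, Real.norm_eq_abs, Real.norm_eq_abs, abs_of_nonneg (hk_nonneg h0 _)]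
        exact mul_le_mul_of_nonneg_left (hA (s, y)) (hk_nonneg h0 _)
    _ = (∫ y : Ed d, heatKernel d (t - s) (x - y)) * (A * rexp (K * |s|)) := by
        rw [integral_mul_const]
    _ ≤ 1 * (A * rexp (K * |s|)) :=
        mul_le_mul_of_nonneg_right (hk_integral_le hd h0 x) (by positivity)
    _ = _ := one_mul _

lemma integrand_meas {d : ℕ} {f : ℝ × Ed d → ℝ} (hf : Measurable f) :
    Measurable (fun r : ((ℝ × Ed d) × ℝ) × Ed d =>
      heatKernel d (r.1.1.1 - r.1.2) (r.1.1.2 - r.2) * f (r.1.2, r.2)) := by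
  refine Measurable.mul ?_ ?_
  · exact (hk_meas d).comp (by fun_prop : Measurable (fun r : ((ℝ × Ed d) × ℝ) × Ed d =>
      ((r.1.1.1 - r.1.2), (r.1.1.2 - r.2))))
  · exact hf.comp (by fun_prop)

lemma inner_meas {d : ℕ} {f : ℝ × Ed d → ℝ} (hf : Measurable f) :
    Measurable (fun r : (ℝ × Ed d) × ℝ =>
      ∫ y : Ed d, heatKernel d (r.1.1 - r.2) (r.1.2 - y) * f (r.2, y)) :=
  ((integrand_meas hf).stronglyMeasurable.integral_prod_right').measurable

lemma GG_meas {d : ℕ} {f : ℝ × Ed d → ℝ} (hf : Measurable f) : Measurable (GG d f) := by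
  have : GG d f = fun p => ∫ s, ({r : (ℝ × Ed d) × ℝ | 0 < r.2 ∧ r.2 ≤ r.1.1}.indicator
      (fun r : (ℝ × Ed d) × ℝ =>
      ∫ y : Ed d, heatKernel d (r.1.1 - r.2) (r.1.2 - y) * f (r.2, y))) (p, s) := by
    funext p
    unfold GG
    rw [← integral_indicator measurableSet_Ioc]
    rfl
  rw [this]
  refine (StronglyMeasurable.integral_prod_right' (Measurable.stronglyMeasurable ?_)).measurable
  refine (inner_meas hf).indicator ?_
  exact (measurableSet_lt measurable_const measurable_snd).inter
    (measurableSet_le measurable_snd (by fun_prop))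

lemma outer_integrable {d : ℕ} (hd : 1 ≤ d) {f : ℝ × Ed d → ℝ} (hf : Measurable f) {A K : ℝ}
    (hA0 : 0 ≤ A) (hA : ∀ q, |f q| ≤ A * rho d K q) (t : ℝ) (x : Ed d) :
    IntegrableOn (fun s => ∫ y : Ed d, heatKernel d (t - s) (x - y) * f (s, y)) (Ioc 0 t) := by
  have hc : IntegrableOn (fun s : ℝ => A * rexp (K * |s|)) (Ioc 0 t) :=
    (Continuous.integrableOn_Icc (by fun_prop)).mono_set Ioc_subset_Icc_self
  refine hc.mono' ?_ ?_
  · exact ((inner_meas hf).comp (by fun_prop : Measurable fun s : ℝ => ((t, x), s))).aestronglyMeasurable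
  · filter_upwards [ae_restrict_mem measurableSet_Ioc] with s hs
    exact inner_abs_le hd hA0 hA hs.2 x

lemma GG_abs_le {d : ℕ} (hd : 1 ≤ d) {f : ℝ × Ed d → ℝ} {A K : ℝ} (hK : 0 < K)
    (hA0 : 0 ≤ A) (hA : ∀ q, |f q| ≤ A * rho d K q) (p : ℝ × Ed d) :
    |GG d f p| ≤ A / K * rho d K p := by
  obtain ⟨t, x⟩ := p
  rcases le_or_gt t 0 with h | h
  · have : Ioc (0:ℝ) t = ∅ := Ioc_eq_empty (by linarith)
    simp only [GG, this, Measure.restrict_empty, integral_zero_measure, abs_zero]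
    unfold rho; positivity
  have hc : IntegrableOn (fun s : ℝ => A * rexp (K * |s|)) (Ioc 0 t) :=
    (Continuous.integrableOn_Icc (by fun_prop)).mono_set Ioc_subset_Icc_self
  calc |GG d f (t, x)| ≤ ∫ s in Ioc 0 t, A * rexp (K * |s|) := by
        rw [← Real.norm_eq_abs]
        refine norm_integral_le_of_norm_le hc ?_
        filter_upwards [ae_restrict_mem measurableSet_Ioc] with s hs
        exact inner_abs_le hd hA0 hA hs.2 x
    _ = ∫ s in Ioc 0 t, A * rexp (K * s) := by
        refine setIntegral_congr_fun measurableSet_Ioc fun s hs => ?_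
        simp only [abs_of_pos hs.1]
    _ = A / K * (rexp (K * t) - 1) := by
        rw [← intervalIntegral.integral_of_le h.le, intervalIntegral.integral_const_mul,
          intervalIntegral.integral_comp_mul_left (fun s => rexp s) hK.ne', integral_exp]
        simp; ring
    _ ≤ _ := by
        unfold rho
        rw [abs_of_pos h]
        refine mul_le_mul_of_nonneg_left (by simp) (by positivity)

lemma GG_add {d : ℕ} (hd : 1 ≤ d) {f g : ℝ × Ed d → ℝ} (hf : Measurable f) (hg : Measurable g)
    {A B K : ℝ} (hA0 : 0 ≤ A) (hA : ∀ q, |f q| ≤ A * rho d K q)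
    (hB0 : 0 ≤ B) (hB : ∀ q, |g q| ≤ B * rho d K q) (p : ℝ × Ed d) :
    GG d (fun q => f q + g q) p = GG d f p + GG d g p := by
  unfold GG
  rw [← integral_add (outer_integrable hd hf hA0 hA _ _) (outer_integrable hd hg hB0 hB _ _)]
  refine setIntegral_congr_fun measurableSet_Ioc fun s hs => ?_
  simp only
  rw [← integral_add (inner_integrable hd hf hA hs.2 _) (inner_integrable hd hg hB hs.2 _)]
  simp_rw [mul_add]

lemma GG_const_mul {d : ℕ} (c : ℝ) (f : ℝ × Ed d → ℝ) (p : ℝ × Ed d) :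
    GG d (fun q => c * f q) p = c * GG d f p := by
  unfold GG
  simp_rw [← integral_const_mul]
  simp_rw [mul_left_comm]

lemma GG_sub {d : ℕ} (hd : 1 ≤ d) {f g : ℝ × Ed d → ℝ} (hf : Measurable f) (hg : Measurable g)
    {A B K : ℝ} (hA0 : 0 ≤ A) (hA : ∀ q, |f q| ≤ A * rho d K q)
    (hB0 : 0 ≤ B) (hB : ∀ q, |g q| ≤ B * rho d K q) (p : ℝ × Ed d) :
    GG d (fun q => f q - g q) p = GG d f p - GG d g p := by
  have h := GG_add hd hf (hg.const_mul (-1)) hA0 hA hB0 (B := B) (K := K)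
    (fun q => by simpa using hB q) p
  rw [GG_const_mul] at h
  rw [sub_eq_add_neg (GG d f p), ← neg_one_mul, ← h]
  congr 1; funext q; ring

lemma GG_nonneg {d : ℕ} {f : ℝ × Ed d → ℝ} (hf : ∀ q, 0 ≤ f q) (p : ℝ × Ed d) :
    0 ≤ GG d f p := by
  unfold GG
  refine setIntegral_nonneg measurableSet_Ioc fun s hs => ?_
  exact integral_nonneg fun y => mul_nonneg (hk_nonneg (sub_nonneg.2 hs.2) _) (hf _)

lemma GG_pos {d : ℕ} (hd : 1 ≤ d) {f : ℝ × Ed d → ℝ} (hf : ∀ q, 0 < f q) (hm : Measurable f)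
    {A K : ℝ} (hA0 : 0 ≤ A)
    (hA : ∀ q, |f q| ≤ A * rho d K q) {t : ℝ} (ht : 0 < t) (x : Ed d) :
    0 < GG d f (t, x) := by
  unfold GG
  have hin : ∀ s, s < t → 0 < ∫ y : Ed d, heatKernel d (t - s) (x - y) * f (s, y) := by
    intro s hs
    rw [integral_pos_iff_support_of_nonneg
      (fun y => mul_nonneg (hk_nonneg (sub_nonneg.2 hs.le) _) (hf _).le)
      (inner_integrable hd hm hA hs.le x)]
    have : Function.support (fun y : Ed d => heatKernel d (t - s) (x - y) * f (s, y)) = univ := by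
      ext y
      simp only [Function.mem_support, mem_univ, iff_true]
      exact (mul_pos (hk_pos (sub_pos.2 hs) _) (hf _)).ne'
    rw [this]; exact isOpen_univ.measure_pos _ univ_nonempty
  rw [setIntegral_pos_iff_support_of_nonneg_ae _ (outer_integrable hd hm hA0 hA t x)]
  · refine lt_of_lt_of_le ?_ (measure_mono (s := Ioo 0 t) ?_)
    · simpa using ht
    · intro s hs
      exact ⟨(hin s hs.2).ne', hs.1, hs.2.le⟩
  · filter_upwards [ae_restrict_mem measurableSet_Ioc] with s hs
    exact integral_nonneg fun y => mul_nonneg (hk_nonneg (sub_nonneg.2 hs.2) _) (hf _).le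

lemma GG_lintegral {d : ℕ} (hd : 1 ≤ d) {f : ℝ × Ed d → ℝ} (hf : Measurable f) {A K : ℝ}
    (hK : 0 ≤ K)
    (hA0 : 0 ≤ A) (hA : ∀ q, |f q| ≤ A * rho d K q) (t : ℝ) (x : Ed d) :
    (∫⁻ s in Ioc (0 : ℝ) t, ∫⁻ y : Ed d,
      ENNReal.ofReal (|heatKernel d (t - s) (x - y) * f (s, y)|)) < ⊤ := by
  calc _ ≤ ∫⁻ s in Ioc (0 : ℝ) t, ENNReal.ofReal (A * rexp (K * |t|)) := by
        refine setLIntegral_mono measurable_const fun s hs => ?_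
        rw [← ofReal_integral_eq_lintegral_ofReal (inner_integrable hd hf hA hs.2 x).abs
          (Filter.Eventually.of_forall fun y => abs_nonneg _)]
        refine ENNReal.ofReal_le_ofReal ?_
        have := inner_abs_le hd (f := fun q => |f q|) hA0 (by simpa using hA) hs.2 x
        have e : ∀ y, |heatKernel d (t - s) (x - y) * f (s, y)|
            = heatKernel d (t - s) (x - y) * |f (s, y)| := fun y => by
          rw [abs_mul, abs_of_nonneg (hk_nonneg (sub_nonneg.2 hs.2) _)]
        simp_rw [e]
        refine (le_abs_self _).trans (this.trans ?_)
        have : |s| ≤ |t| := by rw [abs_of_pos hs.1]; exact hs.2.trans (le_abs_self t)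
        gcongr
    _ < ⊤ := by
        rw [setLIntegral_const]
        exact ENNReal.mul_lt_top ENNReal.ofReal_lt_top (by simp)

/-- the indicator of the unit ball -/
def ind (d : ℕ) (y : Ed d) : ℝ := (Metric.ball (0 : Ed d) 1).indicator (fun _ => 1) y

lemma ind_meas (d : ℕ) : Measurable (ind d) :=
  measurable_const.indicator measurableSet_ball

lemma ind_nonneg (d : ℕ) (y : Ed d) : 0 ≤ ind d y :=
  Set.indicator_nonneg (fun _ _ => zero_le_one) _

lemma ind_integrable (d : ℕ) : Integrable (ind d) := by
  unfold ind
  rw [integrable_indicator_iff measurableSet_ball]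
  exact integrableOn_const (by simp [measure_ball_lt_top.ne])

lemma riesz_local {d : ℕ} (hd : 1 ≤ d) {β : ℝ} (hβ : β < d) :
    Integrable (fun u : Ed d => ind d u * ‖u‖ ^ (-β)) := by
  have : Nonempty (Fin d) := ⟨⟨0, hd⟩⟩
  have h : IntegrableOn (fun u : Ed d => ‖u‖ ^ (-β)) (Metric.ball 0 1) := by
    rw [integrableOn_fun_norm_addHaar volume (f := fun r : ℝ => r ^ (-β))]
    have h1 : IntegrableOn (fun r : ℝ => r ^ ((d:ℝ) - 1 - β)) (Ioo 0 1) := by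
      have := (intervalIntegral.intervalIntegrable_rpow' (a := 0) (b := 1)
        (r := (d:ℝ) - 1 - β) (by linarith))
      rw [intervalIntegrable_iff_integrableOn_Ioo_of_le zero_le_one] at this
      exact this
    refine h1.congr_fun (fun r hr => ?_) measurableSet_Ioo
    simp only [finrank_euclideanSpace, Fintype.card_fin, smul_eq_mul]
    rw [← Real.rpow_natCast, ← Real.rpow_add hr.1, Nat.cast_sub hd]
    simp [sub_eq_add_neg]
  rw [← integrable_indicator_iff measurableSet_ball] at h
  refine h.congr (Filter.Eventually.of_forall fun u => ?_)
  simp only [ind, Set.indicator]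
  split_ifs <;> simp

/-- the potential of the unit ball -/
def UU (d : ℕ) (β : ℝ) (y : Ed d) : ℝ := ∫ y' : Ed d, ‖y - y'‖ ^ (-β) * ind d y'

lemma riesz_meas (d : ℕ) (β : ℝ) :
    Measurable (fun p : Ed d × Ed d => ‖p.1 - p.2‖ ^ (-β) * ind d p.2) := by
  have := ind_meas d
  fun_prop

lemma UU_meas (d : ℕ) (β : ℝ) : Measurable (UU d β) :=
  ((riesz_meas d β).stronglyMeasurable.integral_prod_right').measurable

lemma riesz_le {d : ℕ} {β : ℝ} (hβ : 0 < β) (y y' : Ed d) :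
    ‖y - y'‖ ^ (-β) * ind d y' ≤ ind d (y - y') * ‖y - y'‖ ^ (-β) + ind d y' := by
  have h0 : 0 ≤ ‖y - y'‖ ^ (-β) := by positivity
  by_cases h : ‖y - y'‖ < 1
  · have e : ind d (y - y') = 1 := by simp [ind, h]
    have : ind d y' ≤ 1 := by
      unfold ind; exact Set.indicator_le_self' (fun _ _ => zero_le_one) _
    rw [e]
    nlinarith [ind_nonneg d y']
  · have : ‖y - y'‖ ^ (-β) ≤ 1 :=
      Real.rpow_le_one_of_one_le_of_nonpos (not_lt.1 h) (by linarith)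
    nlinarith [ind_nonneg d y', mul_nonneg (ind_nonneg d (y - y')) h0]

lemma riesz_integrable {d : ℕ} (hd : 1 ≤ d) {β : ℝ} (hβ0 : 0 < β) (hβ : β < d) (y : Ed d) :
    Integrable (fun y' : Ed d => ‖y - y'‖ ^ (-β) * ind d y') := by
  refine (((riesz_local hd hβ).comp_sub_left y).add (ind_integrable d)).mono' ?_ ?_
  · exact ((riesz_meas d β).comp (by fun_prop : Measurable fun y' : Ed d => (y, y'))).aestronglyMeasurable
  · refine Filter.Eventually.of_forall fun y' => ?_
    rw [Real.norm_eq_abs, abs_of_nonneg (mul_nonneg (by positivity) (ind_nonneg _ _))]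
    exact riesz_le hβ0 y y'

lemma UU_bdd {d : ℕ} (hd : 1 ≤ d) {β : ℝ} (hβ0 : 0 < β) (hβ : β < d) :
    ∃ C : ℝ, 0 ≤ C ∧ ∀ y, |UU d β y| ≤ C := by
  have h0 : ∀ y, 0 ≤ UU d β y := fun y =>
    integral_nonneg fun y' => mul_nonneg (by positivity) (ind_nonneg _ _)
  have h1 : ∀ y, UU d β y ≤ (∫ u : Ed d, ind d u * ‖u‖ ^ (-β)) + ∫ u, ind d u := by
    intro y
    rw [← integral_sub_left_eq_self (fun u : Ed d => ind d u * ‖u‖ ^ (-β)) volume y,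
      ← integral_add ((riesz_local hd hβ).comp_sub_left y) (ind_integrable d)]
    exact integral_mono (riesz_integrable hd hβ0 hβ y)
      (((riesz_local hd hβ).comp_sub_left y).add (ind_integrable d)) (fun y' => riesz_le hβ0 y y')
  exact ⟨_, (h0 0).trans (h1 0), fun y => by rw [abs_of_nonneg (h0 y)]; exact h1 y⟩

lemma UU_pos {d : ℕ} (hd : 1 ≤ d) {β : ℝ} (hβ0 : 0 < β) (hβ : β < d) (y : Ed d) :
    0 < UU d β y := by
  have : Nonempty (Fin d) := ⟨⟨0, hd⟩⟩
  unfold UU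
  rw [integral_pos_iff_support_of_nonneg
    (fun y' => mul_nonneg (by positivity) (ind_nonneg _ _)) (riesz_integrable hd hβ0 hβ y)]
  have hs : Metric.ball (0 : Ed d) 1 \ {y} ⊆
      Function.support (fun y' : Ed d => ‖y - y'‖ ^ (-β) * ind d y') := by
    rintro y' ⟨h1, h2⟩
    have e : ind d y' = 1 := by simp [ind, mem_ball_zero_iff.1 h1]
    have : 0 < ‖y - y'‖ := norm_pos_iff.2 (sub_ne_zero.2 fun h => h2 h.symm)
    simp only [Function.mem_support, e, mul_one]
    positivity
  refine lt_of_lt_of_le ?_ (measure_mono hs)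
  rw [measure_sdiff_null (by simp)]
  exact Metric.measure_ball_pos _ _ one_pos

lemma h_adm {d : ℕ} (hd : 1 ≤ d) {β : ℝ} (hβ0 : 0 < β) (hβ : β < d) (T l : ℝ) :
    Admissible d β T (fun _ y => l * ind d y) := by
  obtain ⟨C, hC0, hC⟩ := UU_bdd hd hβ0 hβ
  refine ⟨((ind_meas d).comp measurable_snd).const_mul l, ?_⟩
  rw [setLIntegral_const]
  refine ENNReal.mul_lt_top ?_ (by simp)
  have hI : Integrable (fun y => |l| * |l| * C * ind d y) := (ind_integrable d).const_mul _
  calc _ ≤ ∫⁻ y : Ed d, ENNReal.ofReal (|l| * |l| * C * ind d y) := by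
        refine lintegral_mono fun y => ?_
        have e : ∀ y', |l * ind d y| * |l * ind d y'| * ‖y - y'‖ ^ (-β)
            = (|l| * |l| * ind d y) * (‖y - y'‖ ^ (-β) * ind d y') := fun y' => by
          rw [abs_mul, abs_mul, abs_of_nonneg (ind_nonneg d y), abs_of_nonneg (ind_nonneg d y')]
          ring
        simp only [e]
        have h0 : 0 ≤ |l| * |l| * ind d y := mul_nonneg (by positivity) (ind_nonneg d y)
        rw [← ofReal_integral_eq_lintegral_ofReal ((riesz_integrable hd hβ0 hβ y).const_mul _)
          (Filter.Eventually.of_forall fun y' => mul_nonneg h0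
            (mul_nonneg (by positivity) (ind_nonneg _ _))), integral_const_mul]
        refine ENNReal.ofReal_le_ofReal ?_
        have := mul_le_mul_of_nonneg_left ((le_abs_self _).trans (hC y)) h0
        unfold UU at this
        linarith
    _ < ⊤ := by
        have := hI.lintegral_lt_top
        exact this

/-- fixed points in a weighted space of measurable functions -/
lemma fixed_pt {X : Type*} [MeasurableSpace X] (ρ : X → ℝ)
    (F : (X → ℝ) → (X → ℝ))
    (hF : ∀ f, Measurable f → (∃ A, 0 ≤ A ∧ ∀ p, |f p| ≤ A * ρ p) →
      Measurable (F f) ∧ ∃ A, 0 ≤ A ∧ ∀ p, |F f p| ≤ A * ρ p)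
    (hc : ∀ f g, Measurable f → (∃ A, 0 ≤ A ∧ ∀ p, |f p| ≤ A * ρ p) →
      Measurable g → (∃ A, 0 ≤ A ∧ ∀ p, |g p| ≤ A * ρ p) →
      ∀ A, 0 ≤ A → (∀ p, |f p - g p| ≤ A * ρ p) → ∀ p, |F f p - F g p| ≤ A / 2 * ρ p) :
    ∃ f, Measurable f ∧ (∃ A, 0 ≤ A ∧ ∀ p, |f p| ≤ A * ρ p) ∧ F f = f := by
  let u : ℕ → X → ℝ := fun n => F^[n] (fun _ => 0)
  have hu1 : ∀ n, u (n + 1) = F (u n) := fun n => Function.iterate_succ_apply' _ _ _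
  have hu : ∀ n, Measurable (u n) ∧ ∃ A, 0 ≤ A ∧ ∀ p, |u n p| ≤ A * ρ p := by
    intro n
    induction n with
    | zero => exact ⟨measurable_const, 0, le_rfl, fun p => by simp [u]⟩
    | succ n ih => rw [hu1]; exact hF _ ih.1 ih.2
  obtain ⟨C, hC0, hC⟩ := (hu 1).2
  have hd : ∀ n p, |u n p - u (n + 1) p| ≤ (C / 2 ^ n) * ρ p := by
    intro n
    induction n with
    | zero => intro p; simpa [u] using hC p
    | succ n ih =>
      intro p
      have := hc _ _ (hu n).1 (hu n).2 (hu (n+1)).1 (hu (n+1)).2 _ (by positivity) ih p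
      rw [← hu1, ← hu1] at this
      rw [pow_succ, ← div_div]; exact this
  have hd' : ∀ p n, dist (u n p) (u (n + 1) p) ≤ (2 * C * ρ p) / 2 / 2 ^ n := by
    intro p n
    rw [Real.dist_eq]
    refine (hd n p).trans (le_of_eq ?_)
    ring
  have hlim : ∀ p, ∃ a, Filter.Tendsto (fun n => u n p) Filter.atTop (nhds a) := fun p =>
    cauchySeq_tendsto_of_complete (cauchySeq_of_le_geometric_two (hd' p))
  choose f hf using hlim
  have hfd : ∀ n p, |u n p - f p| ≤ (2 * C / 2 ^ n) * ρ p := by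
    intro n p
    have := dist_le_of_le_geometric_two_of_tendsto (hd' p) (hf p) n
    rw [Real.dist_eq] at this
    refine this.trans (le_of_eq ?_)
    ring
  have hfm : Measurable f := measurable_of_tendsto_metrizable (fun n => (hu n).1)
    (tendsto_pi_nhds.2 hf)
  have hfb : ∃ A, 0 ≤ A ∧ ∀ p, |f p| ≤ A * ρ p := by
    refine ⟨2 * C, by positivity, fun p => ?_⟩
    have := hfd 0 p
    simpa [u] using this
  refine ⟨f, hfm, hfb, ?_⟩
  funext p
  have key : ∀ n, |F f p - f p| ≤ (1/2 : ℝ) ^ n * (2 * C * ρ p) := by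
    intro n
    have h1 := hc _ _ (hu n).1 (hu n).2 hfm hfb _ (by positivity) (hfd n) p
    have h2 := hfd (n + 1) p
    rw [hu1] at h2
    have : |F f p - f p| ≤ |F (u n) p - F f p| + |F (u n) p - f p| := by
      rw [abs_sub_comm (F (u n) p) (F f p)]
      exact abs_sub_le _ _ _
    refine this.trans ((add_le_add h1 h2).trans (le_of_eq ?_))
    rw [pow_succ, one_div, inv_pow]
    field_simp
    ring
  have hl : Filter.Tendsto (fun n : ℕ => (1/2 : ℝ) ^ n * (2 * C * ρ p)) Filter.atTop (nhds 0) := by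
    have := (tendsto_pow_atTop_nhds_zero_of_lt_one (r := (1/2:ℝ)) (by norm_num) (by norm_num)).mul_const (2 * C * ρ p)
    simpa using this
  have := ge_of_tendsto' hl key
  exact sub_eq_zero.1 (abs_eq_zero.1 (le_antisymm this (abs_nonneg _)))

lemma halving {X : Type*} (ρ D : X → ℝ) (c A₀ : ℝ) (hc : 0 ≤ c) (hA : 0 ≤ A₀) (hρ : ∀ p, 0 ≤ ρ p)
    (h0 : ∀ p, D p ≤ A₀ * ρ p)
    (h : ∀ A, 0 ≤ A → (∀ p, D p ≤ A * ρ p) → ∀ p, D p ≤ (A / 2 + c) * ρ p) :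
    ∀ p, D p ≤ 2 * c * ρ p := by
  have key : ∀ n : ℕ, ∀ p, D p ≤ ((1/2:ℝ) ^ n * A₀ + 2 * c) * ρ p := by
    intro n
    induction n with
    | zero =>
      intro p
      simp only [pow_zero, one_mul]
      exact (h0 p).trans (mul_le_mul_of_nonneg_right (by linarith) (hρ p))
    | succ n ih =>
      intro p
      refine (h _ (by positivity) ih p).trans (le_of_eq ?_)
      rw [pow_succ]; ring
  intro p
  have hl : Filter.Tendsto (fun n : ℕ => ((1/2 : ℝ) ^ n * A₀ + 2 * c) * ρ p) Filter.atTop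
      (nhds (2 * c * ρ p)) := by
    have := (((tendsto_pow_atTop_nhds_zero_of_lt_one (r := (1/2:ℝ)) (by norm_num) (by norm_num)).mul_const A₀).add_const (2 * c)).mul_const (ρ p)
    simpa using this
  exact ge_of_tendsto' hl (fun n => key n p)

/-- the nonlinearity -/
def NN (d : ℕ) (β : ℝ) (σ b : ℝ → ℝ) (l : ℝ) (f : ℝ × Ed d → ℝ) (q : ℝ × Ed d) : ℝ :=
  l * (UU d β q.2 * σ (f q)) + b (f q)

lemma one_le_rho {d : ℕ} {K : ℝ} (hK : 0 ≤ K) (p : ℝ × Ed d) : 1 ≤ rho d K p := by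
  unfold rho
  exact Real.one_le_exp (by positivity)

lemma lip_abs {σ : ℝ → ℝ} {L : NNReal} (h : LipschitzWith L σ) (u v : ℝ) :
    |σ u - σ v| ≤ L * |u - v| := by
  simpa [Real.dist_eq] using h.dist_le_mul u v

lemma Usig_bdd {d : ℕ} {β C : ℝ} (hC0 : 0 ≤ C) (hC : ∀ y, |UU d β y| ≤ C) {σ : ℝ → ℝ} {L : NNReal}
    (h : LipschitzWith L σ) {K : ℝ} (hK : 0 ≤ K) {f : ℝ × Ed d → ℝ} {A : ℝ}
    (hA : ∀ q, |f q| ≤ A * rho d K q) (q : ℝ × Ed d) :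
    |UU d β q.2 * σ (f q)| ≤ C * (|σ 0| + L * A) * rho d K q := by
  have h1 : |σ (f q)| ≤ (|σ 0| + L * A) * rho d K q := by
    have h2 := lip_abs h (f q) 0
    have h3 : |σ (f q)| ≤ |σ 0| + |σ (f q) - σ 0| := by
      have := abs_add_le (σ 0) (σ (f q) - σ 0)
      simpa using this
    rw [sub_zero] at h2
    have h4 : (L : ℝ) * |f q| ≤ L * (A * rho d K q) := mul_le_mul_of_nonneg_left (hA q) L.2
    nlinarith [one_le_rho hK q, abs_nonneg (σ 0)]
  rw [abs_mul, mul_assoc]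
  exact mul_le_mul (hC _) h1 (abs_nonneg _) hC0

lemma main_aux {d : ℕ} (hd : 1 ≤ d)
    {β T : ℝ} (hβ0 : 0 < β) (hβ : β < d)
    {σ b : ℝ → ℝ} {L Lb : NNReal} (hσ : LipschitzWith L σ) (hb : LipschitzWith Lb b)
    {M : ℝ} (hM : ∀ x : ℝ, |b x| ≤ M)
    {w' : ℝ × Ed d → ℝ} (hw : Measurable w') {W : ℝ} (hW : ∀ q, |w' q| ≤ W) (R : ℝ) (hR : 0 ≤ R) :
    ∃ (K : ℝ) (Φ : ℝ → ℝ × Ed d → ℝ), 0 < K ∧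
      (∀ l, |l| ≤ R → Measurable (Φ l) ∧ (∃ A, 0 ≤ A ∧ ∀ p, |Φ l p| ≤ A * rho d K p) ∧
        (∀ p, Φ l p = w' p + GG d (NN d β σ b l (Φ l)) p)) ∧
      ∀ p, ContinuousOn (fun l => Φ l p) (Icc (-R) R) := by
  obtain ⟨C, hC0, hC⟩ := UU_bdd hd hβ0 hβ
  have hM0 : 0 ≤ M := (abs_nonneg _).trans (hM 0)
  have hW0 : 0 ≤ W := (abs_nonneg _).trans (hW (0, 0))
  have hL0 : (0:ℝ) ≤ L := L.2
  have hLb0 : (0:ℝ) ≤ Lb := Lb.2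
  set ℓ : ℝ := R * (C * L) + Lb with hℓ
  have hℓ0 : 0 ≤ ℓ := by positivity
  set K : ℝ := 2 * ℓ + 1 with hKdef
  have hK : 0 < K := by positivity
  have hρ : ∀ p, 0 < rho d K p := fun p => Real.exp_pos _
  have hNm : ∀ l f, Measurable f → Measurable (NN d β σ b l f) := by
    intro l f hf
    unfold NN
    have h1 := hσ.continuous.measurable.comp hf
    have h2 := hb.continuous.measurable.comp hf
    exact ((((UU_meas d β).comp measurable_snd).mul h1).const_mul l).add h2
  have hNb : ∀ l f, (∃ A, 0 ≤ A ∧ ∀ p, |f p| ≤ A * rho d K p) →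
      ∃ A, 0 ≤ A ∧ ∀ p, |NN d β σ b l f p| ≤ A * rho d K p := by
    rintro l f ⟨A, hA0, hA⟩
    refine ⟨|l| * (C * (|σ 0| + L * A)) + M, by positivity, fun p => ?_⟩
    unfold NN
    refine (abs_add_le _ _).trans ?_
    rw [add_mul]
    refine add_le_add ?_ ?_
    · rw [abs_mul, mul_assoc]
      exact mul_le_mul_of_nonneg_left (Usig_bdd hC0 hC hσ hK.le hA p) (abs_nonneg _)
    · exact (hM _).trans (le_mul_of_one_le_right hM0 (one_le_rho hK.le p))
  -- difference estimate for the nonlinearity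
  have hNd : ∀ l, |l| ≤ R → ∀ f g p,
      |NN d β σ b l f p - NN d β σ b l g p| ≤ ℓ * |f p - g p| := by
    intro l hl f g p
    have e : NN d β σ b l f p - NN d β σ b l g p
        = l * (UU d β p.2 * (σ (f p) - σ (g p))) + (b (f p) - b (g p)) := by
      unfold NN; ring
    rw [e]
    refine (abs_add_le _ _).trans ?_
    rw [abs_mul, abs_mul, hℓ, add_mul]
    refine add_le_add ?_ (lip_abs hb _ _)
    rw [mul_assoc, mul_assoc]
    exact mul_le_mul hl (mul_le_mul (hC _) (lip_abs hσ _ _) (abs_nonneg _) hC0)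
      (by positivity) hR
  have hex : ∀ l, ∃ f : ℝ × Ed d → ℝ, |l| ≤ R → (Measurable f ∧
      (∃ A, 0 ≤ A ∧ ∀ p, |f p| ≤ A * rho d K p) ∧
        (∀ p, f p = w' p + GG d (NN d β σ b l f) p)) := by
    intro l
    by_cases hl : |l| ≤ R
    · obtain ⟨f, h1, h2, h3⟩ := fixed_pt (rho d K)
        (fun f p => w' p + GG d (NN d β σ b l f) p) (by
          intro f hf hfb
          refine ⟨hw.add (GG_meas (hNm l f hf)), ?_⟩
          obtain ⟨A, hA0, hA⟩ := hNb l f hfb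
          refine ⟨W + A / K, by positivity, fun p => ?_⟩
          refine (abs_add_le _ _).trans ?_
          rw [add_mul]
          exact add_le_add ((hW _).trans (le_mul_of_one_le_right hW0 (one_le_rho hK.le p)))
            (GG_abs_le hd hK hA0 hA p)) (by
          intro f g hf hfb hg hgb A hA0 hA p
          obtain ⟨A1, hA10, hA1⟩ := hNb l f hfb
          obtain ⟨A2, hA20, hA2⟩ := hNb l g hgb
          simp only [add_sub_add_left_eq_sub]
          rw [← GG_sub hd (hNm l f hf) (hNm l g hg) hA10 hA1 hA20 hA2 p]
          refine (GG_abs_le hd hK (A := ℓ * A) (by positivity) (fun q => ?_) p).trans ?_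
          · refine (hNd l hl f g q).trans ?_
            rw [mul_assoc]
            exact mul_le_mul_of_nonneg_left (hA q) hℓ0
          · refine mul_le_mul_of_nonneg_right ?_ (hρ p).le
            rw [div_le_div_iff₀ hK two_pos]
            nlinarith)
      exact ⟨f, fun _ => ⟨h1, h2, fun p => (congrFun h3 p).symm⟩⟩
    · exact ⟨0, fun h => absurd h hl⟩
  choose Φ hΦ using hex
  refine ⟨K, Φ, hK, hΦ, ?_⟩
  intro p
  intro m hm
  have hm' : |m| ≤ R := abs_le.2 hm
  obtain ⟨hmm, ⟨Am, hAm0, hAm⟩, hme⟩ := hΦ m hm'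
  set c : ℝ := C * (|σ 0| + L * Am) / K with hc
  have hc0 : 0 ≤ c := by positivity
  have key : ∀ l ∈ Icc (-R) R, |Φ l p - Φ m p| ≤ 2 * (|l - m| * c) * rho d K p := by
    intro l hl
    have hl' : |l| ≤ R := abs_le.2 hl
    obtain ⟨hlm, ⟨Al, hAl0, hAl⟩, hle⟩ := hΦ l hl'
    refine halving (rho d K) (fun p => |Φ l p - Φ m p|) (|l - m| * c) (Al + Am) (by positivity)
      (by positivity) (fun p => (hρ p).le) (fun q => ?_) (fun A hA0 hA q => ?_) p
    · rw [add_mul]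
      exact (abs_sub _ _).trans (add_le_add (hAl q) (hAm q))
    · obtain ⟨A1, hA10, hA1⟩ := hNb l (Φ l) ⟨Al, hAl0, hAl⟩
      obtain ⟨A2, hA20, hA2⟩ := hNb m (Φ m) ⟨Am, hAm0, hAm⟩
      show |Φ l q - Φ m q| ≤ _
      rw [hle, hme, add_sub_add_left_eq_sub,
        ← GG_sub hd (hNm l _ hlm) (hNm m _ hmm) hA10 hA1 hA20 hA2 q]
      refine (GG_abs_le hd hK (A := ℓ * A + |l - m| * (C * (|σ 0| + L * Am))) (by positivity)
        (fun r => ?_) q).trans ?_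
      · have e : NN d β σ b l (Φ l) r - NN d β σ b m (Φ m) r
            = (NN d β σ b l (Φ l) r - NN d β σ b l (Φ m) r)
              + (l - m) * (UU d β r.2 * σ (Φ m r)) := by
          unfold NN; ring
        rw [e, add_mul]
        refine (abs_add_le _ _).trans (add_le_add ?_ ?_)
        · refine (hNd l hl' _ _ r).trans ?_
          rw [mul_assoc]
          exact mul_le_mul_of_nonneg_left (hA r) hℓ0
        · rw [abs_mul, mul_assoc]
          exact mul_le_mul_of_nonneg_left (Usig_bdd hC0 hC hσ hK.le hAm r) (abs_nonneg _)
      · refine mul_le_mul_of_nonneg_right ?_ (hρ q).le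
        rw [add_div, hc, mul_div_assoc |l - m|]
        refine add_le_add ?_ le_rfl
        rw [div_le_div_iff₀ hK two_pos]
        nlinarith
  show Filter.Tendsto _ _ _
  rw [tendsto_iff_dist_tendsto_zero]
  have hl : Filter.Tendsto (fun l => 2 * (|l - m| * c) * rho d K p)
      (nhdsWithin m (Icc (-R) R)) (nhds 0) := by
    have : Continuous (fun l => 2 * (|l - m| * c) * rho d K p) := by fun_prop
    have := (this.tendsto m).mono_left (nhdsWithin_le_nhds (s := Icc (-R) R))
    simpa using this
  refine squeeze_zero' (Filter.Eventually.of_forall fun _ => dist_nonneg) ?_ hl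
  filter_upwards [self_mem_nhdsWithin] with l hl
  exact key l hl

lemma sign_const {σ : ℝ → ℝ} (hc : Continuous σ) {σ₀ : ℝ} (h0 : 0 < σ₀)
    (h : ∀ x, σ₀ ≤ |σ x|) : ∃ e : ℝ, (e = 1 ∨ e = -1) ∧ ∀ x, σ₀ ≤ e * σ x := by
  by_cases hp : ∃ x, 0 < σ x
  · refine ⟨1, Or.inl rfl, fun x => ?_⟩
    obtain ⟨a, ha⟩ := hp
    rcases le_or_gt (σ x) 0 with hx | hx
    · obtain ⟨y, hy⟩ := mem_range_of_exists_le_of_exists_ge hc ⟨x, hx⟩ ⟨a, ha.le⟩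
      have := h y
      rw [hy, abs_zero] at this
      linarith
    · have := h x
      rw [abs_of_pos hx] at this
      linarith
  · push Not at hp
    refine ⟨-1, Or.inr rfl, fun x => ?_⟩
    have := h x
    rw [abs_of_nonpos (hp x)] at this
    linarith

/-- Let `σ, b` be Lipschitz with `b` bounded and `inf|σ| = σ₀ > 0`, and let `w` be bounded
and continuous on `[0,T]×ℝ^d`. Fix `(t,x) ∈ (0,T]×ℝ^d`. Then for every `z ∈ ℝ` there exists
an admissible `h` such that the unique bounded solution `Φ^h` of the skeleton equation
satisfies `Φ^h(t,x) = z`. -/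
theorem skeleton_surjectivity (d : ℕ) (hd : 1 ≤ d)
    (β T : ℝ) (hβ0 : 0 < β) (hβ : β < min (d : ℝ) 2) (hT : 0 < T)
    (σ b : ℝ → ℝ) (hσ : ∃ L : NNReal, LipschitzWith L σ) (hb : ∃ L : NNReal, LipschitzWith L b)
    (hbbdd : ∃ M : ℝ, ∀ x : ℝ, |b x| ≤ M)
    (σ₀ : ℝ) (hσ₀ : 0 < σ₀) (hσlb : ∀ x : ℝ, σ₀ ≤ |σ x|)
    (w : ℝ → Ed d → ℝ)
    (hwcont : ContinuousOn (fun p : ℝ × Ed d => w p.1 p.2) (Icc (0 : ℝ) T ×ˢ univ))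
    (hwbdd : ∃ M : ℝ, ∀ t ∈ Icc (0 : ℝ) T, ∀ x : Ed d, |w t x| ≤ M)
    (t : ℝ) (ht : t ∈ Ioc (0 : ℝ) T) (x : Ed d) :
    ∀ z : ℝ, ∃ h Φ : ℝ → Ed d → ℝ,
      Admissible d β T h ∧ IsSkeletonSolution d β T σ b w h Φ ∧ Φ t x = z := by
  intro z
  obtain ⟨L, hσ⟩ := hσ
  obtain ⟨Lb, hb⟩ := hb
  obtain ⟨M, hM⟩ := hbbdd
  obtain ⟨W, hW⟩ := hwbdd
  have hβd : β < d := hβ.trans_le (min_le_left _ _)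
  obtain ⟨C, hC0, hC⟩ := UU_bdd hd hβ0 hβd
  have hM0 : 0 ≤ M := (abs_nonneg _).trans (hM 0)
  let w' : ℝ × Ed d → ℝ := fun q => w (max 0 (min q.1 T)) q.2
  have hmem : ∀ s : ℝ, max 0 (min s T) ∈ Icc (0:ℝ) T := fun s =>
    ⟨le_max_left _ _, max_le hT.le (min_le_right _ _)⟩
  have hw'm : Measurable w' := by
    have : Continuous w' := hwcont.comp_continuous
      (f := fun q : ℝ × Ed d => (max 0 (min q.1 T), q.2)) (by fun_prop)
      (fun q => ⟨hmem q.1, mem_univ _⟩)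
    exact this.measurable
  have hw'W : ∀ q, |w' q| ≤ W := fun q => hW _ (hmem q.1) q.2
  have hw'e : ∀ s ∈ Icc (0:ℝ) T, ∀ y, w' (s, y) = w s y := by
    intro s hs y
    simp only [w', min_eq_left hs.2, max_eq_right hs.1]
  obtain ⟨e, he, hes⟩ := sign_const hσ.continuous hσ₀ hσlb
  have hee : e * e = 1 := by rcases he with rfl | rfl <;> norm_num
  have hea : |e| = 1 := by rcases he with rfl | rfl <;> norm_num
  have hUm : Measurable (fun q : ℝ × Ed d => UU d β q.2) := (UU_meas d β).comp measurable_snd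
  set c : ℝ := GG d (fun q => UU d β q.2) (t, x) with hc
  have hUb : ∀ K, 0 ≤ K → ∀ q : ℝ × Ed d, |UU d β q.2| ≤ C * rho d K q := fun K hK q =>
    (hC _).trans (le_mul_of_one_le_right hC0 (one_le_rho hK q))
  have hcpos : 0 < c := GG_pos hd (fun q => UU_pos hd hβ0 hβd q.2) hUm hC0 (hUb 0 le_rfl) ht.1 x
  set B : ℝ := |z| + W + M * rho d 1 (t, x) with hB
  have hW0 : 0 ≤ W := (abs_nonneg _).trans (hw'W (0, 0))
  have hB0 : 0 ≤ B := by
    have : 0 ≤ rho d 1 (t, x) := zero_le_one.trans (one_le_rho zero_le_one _)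
    positivity
  set R : ℝ := B / (σ₀ * c) with hR
  have hR0 : 0 ≤ R := by positivity
  have hRc : R * (σ₀ * c) = B := by rw [hR]; field_simp
  obtain ⟨K, Φ, hK, hΦ, hΦc⟩ := main_aux (T := T) hd hβ0 hβd hσ hb hM hw'm hw'W R hR0
  have hσm : ∀ l, |l| ≤ R → Measurable (fun q : ℝ × Ed d => UU d β q.2 * σ (Φ l q)) :=
    fun l hl => hUm.mul (hσ.continuous.measurable.comp (hΦ l hl).1)
  have hbm : ∀ l, |l| ≤ R → Measurable (fun q : ℝ × Ed d => b (Φ l q)) :=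
    fun l hl => hb.continuous.measurable.comp (hΦ l hl).1
  have hbb : ∀ K, 0 ≤ K → ∀ l, ∀ q : ℝ × Ed d, |b (Φ l q)| ≤ M * rho d K q := fun K hK l q =>
    (hM _).trans (le_mul_of_one_le_right hM0 (one_le_rho hK q))
  have hσb : ∀ l, |l| ≤ R → ∃ A, 0 ≤ A ∧ ∀ q : ℝ × Ed d,
      |UU d β q.2 * σ (Φ l q)| ≤ A * rho d K q := by
    intro l hl
    obtain ⟨A, hA0, hA⟩ := (hΦ l hl).2.1
    exact ⟨C * (|σ 0| + L * A), by positivity, Usig_bdd hC0 hC hσ hK.le hA⟩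
  have hsplit : ∀ l, |l| ≤ R → ∀ p, Φ l p = w' p
      + l * GG d (fun q => UU d β q.2 * σ (Φ l q)) p + GG d (fun q => b (Φ l q)) p := by
    intro l hl p
    obtain ⟨A, hA0, hA⟩ := hσb l hl
    conv_lhs => rw [(hΦ l hl).2.2 p]
    rw [add_assoc, ← GG_const_mul]
    congr 1
    refine GG_add hd ((hσm l hl).const_mul l) (hbm l hl) (A := |l| * A) (by positivity)
      (fun q => ?_) hM0 (hbb K hK.le l) p
    rw [abs_mul, mul_assoc]
    exact mul_le_mul_of_nonneg_left (hA q) (abs_nonneg _)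
  -- lower bound on the noise term
  have hlow : ∀ l, |l| ≤ R → σ₀ * c ≤ e * GG d (fun q => UU d β q.2 * σ (Φ l q)) (t, x) := by
    intro l hl
    obtain ⟨A, hA0, hA⟩ := hσb l hl
    rw [hc, ← GG_const_mul, ← GG_const_mul, ← sub_nonneg]
    rw [← GG_sub hd ((hσm l hl).const_mul e) (hUm.const_mul σ₀) (A := A) hA0
      (fun q => by rw [abs_mul, hea, one_mul]; exact hA q) (B := σ₀ * C) (by positivity)
      (fun q => by
        rw [abs_mul, abs_of_pos hσ₀, mul_assoc]
        exact mul_le_mul_of_nonneg_left (hUb K hK.le q) hσ₀.le)]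
    refine GG_nonneg (fun q => ?_) _
    nlinarith [UU_pos hd hβ0 hβd q.2, hes (Φ l q)]
  have hdr : ∀ l, |GG d (fun q => b (Φ l q)) (t, x)| ≤ M * rho d 1 (t, x) := by
    intro l
    have := GG_abs_le hd one_pos hM0 (hbb 1 zero_le_one l) (t, x)
    simpa using this
  have hIVT : ∃ l, |l| ≤ R ∧ Φ l (t, x) = z := by
    have hcont : ContinuousOn (fun m : ℝ => Φ (e * m) (t, x)) (Icc (-R) R) := by
      refine (hΦc (t, x)).comp (f := fun m => e * m) (by fun_prop) ?_
      intro m hm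
      exact abs_le.1 (by rw [abs_mul, hea, one_mul]; exact abs_le.2 hm)
    have h1 : z ≤ Φ (e * R) (t, x) := by
      have hl : |e * R| ≤ R := by rw [abs_mul, hea, one_mul, abs_of_nonneg hR0]
      rw [hsplit _ hl]
      have a1 := hlow _ hl
      have a2 := mul_le_mul_of_nonneg_left a1 hR0
      have a3 := abs_le.1 (hdr (e * R))
      have a4 := abs_le.1 (hw'W (t, x))
      have a5 := le_abs_self z
      rw [hRc] at a2
      linarith
    have h2 : Φ (e * (-R)) (t, x) ≤ z := by
      have hl : |e * (-R)| ≤ R := by rw [abs_mul, hea, one_mul, abs_neg, abs_of_nonneg hR0]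
      rw [hsplit _ hl]
      have a1 := hlow _ hl
      have a2 := mul_le_mul_of_nonneg_left a1 hR0
      have a3 := abs_le.1 (hdr (e * (-R)))
      have a4 := abs_le.1 (hw'W (t, x))
      have a5 := neg_abs_le z
      rw [hRc] at a2
      linarith
    obtain ⟨m, hm, hmz⟩ := intermediate_value_Icc (by linarith) hcont ⟨h2, h1⟩
    exact ⟨e * m, by rw [abs_mul, hea, one_mul]; exact abs_le.2 hm, hmz⟩
  obtain ⟨l, hl, hlz⟩ := hIVT
  obtain ⟨A, hA0, hA⟩ := hσb l hl
  refine ⟨fun _ y => l * ind d y, fun s y => Φ l (s, y), h_adm hd hβ0 hβd T l, ?_, hlz⟩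
  refine ⟨(hΦ l hl).1, ?_, ?_, ?_, ?_⟩
  · obtain ⟨A', hA0', hA'⟩ := (hΦ l hl).2.1
    refine ⟨A' * rexp (K * T), fun s hs y => (hA' (s, y)).trans ?_⟩
    refine mul_le_mul_of_nonneg_left ?_ hA0'
    unfold rho
    rw [abs_of_nonneg hs.1]
    exact Real.exp_le_exp.2 (mul_le_mul_of_nonneg_left hs.2 hK.le)
  · intro s _ y
    refine lt_of_eq_of_lt ?_ (GG_lintegral hd ((hσm l hl).const_mul l) hK.le
      (A := |l| * A) (by positivity) (fun q => by
        rw [abs_mul, mul_assoc]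
        exact mul_le_mul_of_nonneg_left (hA q) (abs_nonneg _)) s y)
    refine lintegral_congr fun r => lintegral_congr fun v => ?_
    have e1 : ∀ v', |heatKernel d (s - r) (y - v) * σ (Φ l (r, v)) * ‖v - v'‖ ^ (-β) * (l * ind d v')|
        = |heatKernel d (s - r) (y - v) * σ (Φ l (r, v)) * l| * (‖v - v'‖ ^ (-β) * ind d v') := by
      intro v'
      rw [← abs_of_nonneg (mul_nonneg (by positivity : 0 ≤ ‖v - v'‖ ^ (-β)) (ind_nonneg d v')),
        ← abs_mul]
      congr 1; ring
    simp only [e1]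
    rw [← ofReal_integral_eq_lintegral_ofReal ((riesz_integrable hd hβ0 hβd v).const_mul _)
      (Filter.Eventually.of_forall fun v' => mul_nonneg (abs_nonneg _)
        (mul_nonneg (by positivity) (ind_nonneg _ _))), integral_const_mul]
    congr 1
    change _ * UU d β v = _
    rw [← abs_of_pos (UU_pos hd hβ0 hβd v), ← abs_mul, abs_of_pos (UU_pos hd hβ0 hβd v)]
    congr 1; ring
  · intro s _ y
    exact GG_lintegral hd (hbm l hl) hK.le hM0 (hbb K hK.le l) s y
  · intro s hs y
    show Φ l (s, y) = _
    rw [hsplit l hl (s, y), hw'e s hs y]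
    congr 2
    rw [← GG_const_mul]
    unfold GG
    refine integral_congr_ae (Filter.Eventually.of_forall fun r => ?_)
    refine integral_congr_ae (Filter.Eventually.of_forall fun v => ?_)
    have e1 : ∀ v', heatKernel d (s - r) (y - v) * σ (Φ l (r, v)) * ‖v - v'‖ ^ (-β) * (l * ind d v')
        = (heatKernel d (s - r) (y - v) * σ (Φ l (r, v)) * l) * (‖v - v'‖ ^ (-β) * ind d v') := by
      intro v'; ring
    simp only [e1]
    rw [integral_const_mul]
    change _ = _ * UU d β v
    ring

end
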